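/- arXiv:2301.04095 — 2 statements merged into one kernel-verified Lean document; each statement's English description precedes it below -/
import Mathlib

section
/- Let 1 ≤ p ≤ 2 and let g : ℝ^J × ℝ → ℝ satisfy the LBL condition with constant L. Let (Y, X) be a pair of random variables with Y taking values in ℝ^J and X real-valued with E[|X|^p] < ∞, and set γ(Y) := E[X | Y]. For each n ≥ 1 let X(1), …, X(2ⁿ) be conditionally i.i.d. given Y, each with the conditional distribution of X given Y, and set Δ_n := Δ_n(g(Y, ·); X(1), …, X(2ⁿ)). Then there exists a constant C depending only on p such that for every n ≥ 1, E[|Δ_n|^p] ≤ C · L^p · E[|X|^p] · 2^{−(p−1)n}. -/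
open MeasureTheory ProbabilityTheory
open scoped ENNReal

/-- The antithetic multilevel difference `Δ_n(h; a₁, …, a_{2ⁿ})` (0-indexed sequence). -/
noncomputable def deltaN (h : ℝ → ℝ) (n : ℕ) (a : ℕ → ℝ) : ℝ :=
  if n = 0 then h (a 0)
  else h ((∑ i ∈ Finset.range (2 ^ n), a i) / 2 ^ n) -
    (1 / 2) * (h ((∑ k ∈ Finset.range (2 ^ (n - 1)), a (2 * k)) / 2 ^ (n - 1)) +
      h ((∑ k ∈ Finset.range (2 ^ (n - 1)), a (2 * k + 1)) / 2 ^ (n - 1)))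

/-- `g : ℝ^J × ℝ → ℝ` satisfies the LBL condition with constant `L`:
`|g(y,x) − g(y,z)| ≤ L|x − z|` for all `y` and all `x, z`. -/
def LBL {J : Type*} (g : J → ℝ → ℝ) (L : ℝ) : Prop :=
  ∀ y, ∀ x z : ℝ, |g y x - g y z| ≤ L * |x - z|

/-- One half of Clarkson's inequality on the real line. -/
theorem abs_add_rpow_add_abs_sub_rpow_le {p : ℝ} (hp0 : 0 ≤ p) (hp2 : p ≤ 2) (a b : ℝ) :
    |a + b| ^ p + |a - b| ^ p ≤ 2 * (|a| ^ p + |b| ^ p) := by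
  have key (x : ℝ) : |x| ^ p = (x ^ 2) ^ (p / 2) := by
    rw [← sq_abs x, ← Real.rpow_natCast_mul (abs_nonneg x)]
    congr 1
    push_cast
    ring
  have hconc := (Real.concaveOn_rpow (p := p / 2) (by linarith) (by linarith)).2
    (Set.mem_Ici.2 (sq_nonneg (a + b))) (Set.mem_Ici.2 (sq_nonneg (a - b)))
    (show (0 : ℝ) ≤ 1 / 2 by norm_num) (show (0 : ℝ) ≤ 1 / 2 by norm_num) (by norm_num)
  have hsub := Real.rpow_add_le_add_rpow (sq_nonneg a) (sq_nonneg b)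
    (p := p / 2) (by linarith) (by linarith)
  have hmid : (1 / 2 : ℝ) • (a + b) ^ 2 + (1 / 2 : ℝ) • (a - b) ^ 2 = a ^ 2 + b ^ 2 := by
    simp only [smul_eq_mul]
    ring
  rw [hmid] at hconc
  simp only [smul_eq_mul] at hconc
  simp only [key]
  linarith

/-- A von Bahr–Esseen type inequality: the `p`-th moment of a sum of functions, each of which
can be flipped in sign by a measure-preserving map fixing the previous ones, is at most the sum
of the `p`-th moments. -/
theorem lintegral_abs_sum_rpow_le_of_signFlip {α : Type*} [MeasurableSpace α] {ν : Measure α}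
    {p : ℝ} (hp0 : 0 < p) (hp2 : p ≤ 2) {D : ℕ → α → ℝ} (hD : ∀ k, Measurable (D k)) (K : ℕ)
    (hT : ∀ k < K, ∃ T : α → α, MeasurePreserving T ν ν ∧ (∀ x, D k (T x) = -D k x) ∧
      ∀ i < k, ∀ x, D i (T x) = D i x) :
    ∫⁻ x, ENNReal.ofReal (|∑ i ∈ Finset.range K, D i x| ^ p) ∂ν ≤
      ∑ i ∈ Finset.range K, ∫⁻ x, ENNReal.ofReal (|D i x| ^ p) ∂ν := by
  induction K with
  | zero => simp [Real.zero_rpow hp0.ne']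
  | succ K ih =>
    obtain ⟨T, hTm, hTK, hTi⟩ := hT K K.lt_succ_self
    set S : α → ℝ := fun x => ∑ i ∈ Finset.range K, D i x
    have hSm : Measurable S := Finset.measurable_fun_sum _ fun i _ => hD i
    have hST (x : α) : S (T x) = S x :=
      Finset.sum_congr rfl fun i hi => hTi i (Finset.mem_range.1 hi) x
    have hmeas {f : α → ℝ} (hf : Measurable f) :
        Measurable fun x => ENNReal.ofReal (|f x| ^ p) := by fun_prop
    have hSD : Measurable fun x => S x + D K x := hSm.add (hD K)
    have hflip : ∫⁻ x, ENNReal.ofReal (|S x - D K x| ^ p) ∂ν =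
        ∫⁻ x, ENNReal.ofReal (|S x + D K x| ^ p) ∂ν := by
      rw [← hTm.lintegral_comp (hmeas hSD)]
      simp only [hST, hTK, sub_eq_add_neg]
    have htwo : 2 * ∫⁻ x, ENNReal.ofReal (|S x + D K x| ^ p) ∂ν ≤
        2 * (∫⁻ x, ENNReal.ofReal (|S x| ^ p) ∂ν + ∫⁻ x, ENNReal.ofReal (|D K x| ^ p) ∂ν) := by
      conv_lhs => rw [two_mul]
      nth_rewrite 2 [← hflip]
      rw [← lintegral_add_left (hmeas hSD), ← lintegral_add_left (hmeas hSm),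
        ← lintegral_const_mul' _ _ ENNReal.ofNat_ne_top]
      refine lintegral_mono fun x => ?_
      rw [← ENNReal.ofReal_ofNat 2]
      rw [← ENNReal.ofReal_add (by positivity) (by positivity),
        ← ENNReal.ofReal_add (by positivity) (by positivity),
        ← ENNReal.ofReal_mul (by positivity)]
      exact ENNReal.ofReal_le_ofReal (abs_add_rpow_add_abs_sub_rpow_le hp0.le hp2 _ _)
    simp only [Finset.sum_range_succ]
    calc ∫⁻ x, ENNReal.ofReal (|S x + D K x| ^ p) ∂ν
        ≤ ∫⁻ x, ENNReal.ofReal (|S x| ^ p) ∂ν + ∫⁻ x, ENNReal.ofReal (|D K x| ^ p) ∂ν :=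
          (ENNReal.mul_le_mul_iff_right two_ne_zero ENNReal.ofNat_ne_top).1 htwo
      _ ≤ _ := by
          gcongr
          exact ih fun k hk => hT k (hk.trans K.lt_succ_self)

/-- Extension by zero of a finite tuple to a sequence. -/
def zeroExtend {N : ℕ} (x : Fin N → ℝ) (i : ℕ) : ℝ :=
  if h : i < N then x ⟨i, h⟩ else 0

theorem measurable_zeroExtend {N : ℕ} (i : ℕ) :
    Measurable fun x : Fin N → ℝ => zeroExtend x i := by
  unfold zeroExtend
  split_ifs <;> fun_prop

/-- Under a product measure, alternating sums of `2 * m` i.i.d. coordinates have `p`-th moment at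
most `4 * m` times that of a single coordinate. -/
theorem lintegral_pi_abs_alternatingSum_rpow_le {p : ℝ} (hp0 : 0 < p) (hp2 : p ≤ 2) {m N : ℕ}
    (hN : N = 2 * m) (ν : Measure ℝ) [IsProbabilityMeasure ν] :
    ∫⁻ x, ENNReal.ofReal
        (|∑ k ∈ Finset.range m, (zeroExtend x (2 * k) - zeroExtend x (2 * k + 1))| ^ p)
        ∂(Measure.pi fun _ : Fin N => ν) ≤
      (4 * m : ℕ) * ∫⁻ t, ENNReal.ofReal (|t| ^ p) ∂ν := by
  have hmom (i : Fin N) : ∫⁻ x, ENNReal.ofReal (|x i| ^ p) ∂(Measure.pi fun _ : Fin N => ν) =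
      ∫⁻ t, ENNReal.ofReal (|t| ^ p) ∂ν :=
    (measurePreserving_eval (fun _ : Fin N => ν) i).lintegral_comp
      (f := fun t => ENNReal.ofReal (|t| ^ p)) (by fun_prop)
  refine (lintegral_abs_sum_rpow_le_of_signFlip hp0 hp2
    (D := fun k (x : Fin N → ℝ) => zeroExtend x (2 * k) - zeroExtend x (2 * k + 1))
    (fun k => (measurable_zeroExtend _).sub (measurable_zeroExtend _)) m ?_).trans ?_
  · intro k hk
    let i : Fin N := ⟨2 * k, by omega⟩
    let j : Fin N := ⟨2 * k + 1, by omega⟩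
    refine ⟨fun x => x ∘ Equiv.swap i j, ?_, ?_, ?_⟩
    · convert measurePreserving_piCongrLeft (fun _ : Fin N => ν) (Equiv.swap i j) using 1
      ext x l
      obtain ⟨l, rfl⟩ := (Equiv.swap i j).surjective l
      simp [MeasurableEquiv.coe_piCongrLeft, Equiv.piCongrLeft_apply_apply]
    · intro x
      have hi : 2 * k < N := by omega
      have hj : 2 * k + 1 < N := by omega
      have h1 : Equiv.swap i j ⟨2 * k, hi⟩ = j := Equiv.swap_apply_left i j
      have h2 : Equiv.swap i j ⟨2 * k + 1, hj⟩ = i := Equiv.swap_apply_right i j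
      simp [zeroExtend, hi, hj, h1, h2, i, j]
    · intro l hl x
      have hz (r : ℕ) (hr : r < 2 * k) : zeroExtend (x ∘ Equiv.swap i j) r = zeroExtend x r := by
        have hrN : r < N := by omega
        have : Equiv.swap i j ⟨r, hrN⟩ = ⟨r, hrN⟩ :=
          Equiv.swap_apply_of_ne_of_ne (by simp [i, Fin.ext_iff]; omega)
            (by simp [j, Fin.ext_iff]; omega)
        simp [zeroExtend, hrN, this]
      simp only [hz (2 * l) (by omega), hz (2 * l + 1) (by omega)]
  · calc _ ≤ ∑ k ∈ Finset.range m, 4 * ∫⁻ t, ENNReal.ofReal (|t| ^ p) ∂ν := by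
          refine Finset.sum_le_sum fun k hk => ?_
          rw [Finset.mem_range] at hk
          have hi : 2 * k < N := by omega
          have hj : 2 * k + 1 < N := by omega
          simp only [zeroExtend, hi, hj, dif_pos]
          calc _ ≤ ∫⁻ x, 2 * (ENNReal.ofReal (|x ⟨2 * k, hi⟩| ^ p) +
                  ENNReal.ofReal (|x ⟨2 * k + 1, hj⟩| ^ p)) ∂(Measure.pi fun _ : Fin N => ν) := by
                refine lintegral_mono fun x => ?_
                rw [← ENNReal.ofReal_ofNat 2, ← ENNReal.ofReal_add (by positivity) (by positivity),
                  ← ENNReal.ofReal_mul (by positivity)]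
                refine ENNReal.ofReal_le_ofReal (le_trans ?_
                  (abs_add_rpow_add_abs_sub_rpow_le hp0.le hp2 _ _))
                exact le_add_of_nonneg_left (by positivity)
            _ = _ := by
                rw [lintegral_const_mul _ (by fun_prop), lintegral_add_left (by fun_prop),
                  hmom, hmom]
                ring
      _ = _ := by
          simp only [Finset.sum_const, Finset.card_range, nsmul_eq_mul]
          push_cast
          ring

/-- A Lipschitz function turns the antithetic difference into an alternating sum. -/
theorem abs_deltaN_succ_le {h : ℝ → ℝ} {L : ℝ} (hh : ∀ x z, |h x - h z| ≤ L * |x - z|)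
    (n : ℕ) (a : ℕ → ℝ) :
    |deltaN h (n + 1) a| ≤
      L * |∑ k ∈ Finset.range (2 ^ n), (a (2 * k) - a (2 * k + 1))| / 2 ^ (n + 1) := by
  have hsplit : ∑ i ∈ Finset.range (2 ^ (n + 1)), a i =
      ∑ k ∈ Finset.range (2 ^ n), a (2 * k) + ∑ k ∈ Finset.range (2 ^ n), a (2 * k + 1) := by
    rw [pow_succ, mul_comm, ← Finset.sum_add_distrib]
    induction 2 ^ n with
    | zero => simp
    | succ m ih => rw [Nat.mul_succ, Finset.sum_range_succ, Finset.sum_range_succ, ih,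
        Finset.sum_range_succ]; ring
  simp only [deltaN, Nat.add_one_ne_zero, if_false, Nat.add_sub_cancel, hsplit,
    Finset.sum_sub_distrib]
  generalize ∑ k ∈ Finset.range (2 ^ n), a (2 * k) = u
  generalize ∑ k ∈ Finset.range (2 ^ n), a (2 * k + 1) = v
  have hpos : (0 : ℝ) < 2 ^ (n + 1) := by positivity
  have h1 : |(u + v) / 2 ^ (n + 1) - u / 2 ^ n| = |u - v| / 2 ^ (n + 1) := by
    rw [← abs_sub_comm v u, ← abs_of_pos hpos, ← abs_div, abs_of_pos hpos]
    congr 1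
    field_simp
    ring
  have h2 : |(u + v) / 2 ^ (n + 1) - v / 2 ^ n| = |u - v| / 2 ^ (n + 1) := by
    rw [← abs_of_pos hpos, ← abs_div, abs_of_pos hpos]
    congr 1
    field_simp
    ring
  have e1 := hh ((u + v) / 2 ^ (n + 1)) (u / 2 ^ n)
  have e2 := hh ((u + v) / 2 ^ (n + 1)) (v / 2 ^ n)
  rw [h1, abs_le] at e1
  rw [h2, abs_le] at e2
  rw [mul_div_assoc, abs_le]
  constructor <;> linarith [e1.1, e1.2, e2.1, e2.2]

/-- for `1 ≤ p ≤ 2` and `g` satisfying LBL with constant `L`, there is a constant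
`C` depending only on `p` such that whenever `(Y, X)` has `E[|X|^p] < ∞` and, for each `n ≥ 1`,
`X(1), …, X(2ⁿ)` are conditionally i.i.d. given `Y` with the conditional distribution of `X`
given `Y`, the quantity `Δ_n := Δ_n(g(Y,·); X(1), …, X(2ⁿ))` satisfies
`E[|Δ_n|^p] ≤ C · L^p · E[|X|^p] · 2^{−(p−1)n}`. -/
theorem stmt_9 (p : ℝ) (hp1 : 1 ≤ p) (hp2 : p ≤ 2) :
    ∃ C : ℝ, ∀ (Ω : Type*) (J : ℕ) [MeasurableSpace Ω]
      (L : ℝ) (g : (Fin J → ℝ) → ℝ → ℝ), LBL g L →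
      ∀ (μ : Measure Ω) [IsProbabilityMeasure μ]
        (Y : Ω → Fin J → ℝ) (X : Ω → ℝ)
        (Xs : (n : ℕ) → Fin (2 ^ n) → Ω → ℝ)
        (κ : Kernel (Fin J → ℝ) ℝ) [IsMarkovKernel κ]
        (κpi : (n : ℕ) → Kernel (Fin J → ℝ) (Fin (2 ^ n) → ℝ)),
        Measurable Y → Measurable X → (∀ n i, Measurable (Xs n i)) →
        -- `κ` is a version of the conditional distribution of `X` given `Y`:
        μ.map (fun ω => (Y ω, X ω)) = (μ.map Y) ⊗ₘ κ →
        -- conditionally on `Y`, the `X(i)` are i.i.d. with law `κ Y`: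
        (∀ n y, κpi n y = Measure.pi fun _ : Fin (2 ^ n) => κ y) →
        (∀ n : ℕ, μ.map (fun ω => (Y ω, fun i : Fin (2 ^ n) => Xs n i ω)) =
          (μ.map Y) ⊗ₘ κpi n) →
        ∫⁻ ω, ENNReal.ofReal (|X ω| ^ p) ∂μ < ⊤ →
        ∀ n : ℕ, 1 ≤ n →
          ∫⁻ ω, ENNReal.ofReal
              (|deltaN (g (Y ω)) n
                  (fun i => if h : i < 2 ^ n then Xs n ⟨i, h⟩ ω else 0)| ^ p) ∂μ ≤
            ENNReal.ofReal (C * L ^ p) * (∫⁻ ω, ENNReal.ofReal (|X ω| ^ p) ∂μ) *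
              ENNReal.ofReal ((2 : ℝ) ^ (-((p - 1) * n))) := by
  refine ⟨2, ?_⟩
  intro Ω J _ L g hg μ _ Y X Xs κ _ κpi hY hX hXs hXY hpi hXsY _ n hn
  have hp0 : 0 < p := by linarith
  have hL : 0 ≤ L := by simpa using (abs_nonneg _).trans (hg 0 0 1)
  obtain ⟨n, rfl⟩ : ∃ m, n = m + 1 := ⟨n - 1, by omega⟩
  have : IsMarkovKernel (κpi (n + 1)) := ⟨fun y => by rw [hpi]; infer_instance⟩
  have : IsProbabilityMeasure (μ.map Y) := Measure.isProbabilityMeasure_map hY.aemeasurable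
  set F : (Fin (2 ^ (n + 1)) → ℝ) → ℝ≥0∞ := fun x => ENNReal.ofReal
    (|∑ k ∈ Finset.range (2 ^ n), (zeroExtend x (2 * k) - zeroExtend x (2 * k + 1))| ^ p) with hF
  have hFm : Measurable F := by
    have := fun i => measurable_zeroExtend (N := 2 ^ (n + 1)) i
    fun_prop
  have hXmom : ∫⁻ ω, ENNReal.ofReal (|X ω| ^ p) ∂μ =
      ∫⁻ y, ∫⁻ t, ENNReal.ofReal (|t| ^ p) ∂κ y ∂μ.map Y := by
    rw [← Measure.lintegral_compProd (f := fun q => ENNReal.ofReal (|q.2| ^ p)) (by fun_prop),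
      ← hXY, lintegral_map (by fun_prop) (by fun_prop)]
  have hFmom : ∫⁻ ω, F (fun i => Xs (n + 1) i ω) ∂μ ≤
      (4 * 2 ^ n : ℕ) * ∫⁻ ω, ENNReal.ofReal (|X ω| ^ p) ∂μ := by
    calc ∫⁻ ω, F (fun i => Xs (n + 1) i ω) ∂μ
        = ∫⁻ y, ∫⁻ x, F x ∂κpi (n + 1) y ∂μ.map Y := by
          rw [← Measure.lintegral_compProd (f := fun q => F q.2) (by fun_prop),
            ← hXsY, lintegral_map (by fun_prop) (by fun_prop)]
      _ ≤ ∫⁻ y, (4 * 2 ^ n : ℕ) * ∫⁻ t, ENNReal.ofReal (|t| ^ p) ∂κ y ∂μ.map Y := by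
          refine lintegral_mono fun y => ?_
          rw [hpi]
          exact lintegral_pi_abs_alternatingSum_rpow_le hp0 hp2 (pow_succ' 2 n) (κ y)
      _ = _ := by
          rw [lintegral_const_mul' _ _ (ENNReal.natCast_ne_top _), hXmom]
  have hpow : (2 : ℝ) ^ (-((p - 1) * (n + 1 : ℕ))) = 2 ^ (n + 1) / (2 ^ (n + 1)) ^ p := by
    rw [← Real.rpow_natCast, ← Real.rpow_mul (by norm_num), ← Real.rpow_sub (by norm_num)]
    congr 1
    ring
  calc _ ≤ ∫⁻ ω, ENNReal.ofReal ((L / 2 ^ (n + 1)) ^ p) * F (fun i => Xs (n + 1) i ω) ∂μ := by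
        refine lintegral_mono fun ω => ?_
        rw [hF, ← ENNReal.ofReal_mul (by positivity), ← Real.mul_rpow (by positivity)
          (by positivity)]
        refine ENNReal.ofReal_le_ofReal (Real.rpow_le_rpow (abs_nonneg _) ?_ hp0.le)
        rw [div_mul_eq_mul_div]
        exact abs_deltaN_succ_le (hg (Y ω)) n _
    _ = ENNReal.ofReal ((L / 2 ^ (n + 1)) ^ p) * ∫⁻ ω, F (fun i => Xs (n + 1) i ω) ∂μ :=
        lintegral_const_mul' _ _ ENNReal.ofReal_ne_top
    _ ≤ ENNReal.ofReal ((L / 2 ^ (n + 1)) ^ p) *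
          ((4 * 2 ^ n : ℕ) * ∫⁻ ω, ENNReal.ofReal (|X ω| ^ p) ∂μ) := by gcongr
    _ = _ := by
        rw [← mul_assoc, mul_right_comm (ENNReal.ofReal (2 * L ^ p)),
          ← ENNReal.ofReal_natCast, ← ENNReal.ofReal_mul (by positivity),
          ← ENNReal.ofReal_mul (by positivity), hpow, Real.div_rpow hL (by positivity)]
        congr 2
        push_cast
        ring
end

section
/- Let p ≥ 1, let A > 0 and β > 0, and let (Δ_n)_{n≥0} be a sequence of real random variables with E[|Δ_n|^p] ≤ A · 2^{−βn} for every n ≥ 0. Let N ~ Geo(r) be independent of the sequence, where r = 1 − 2^{−k} with k > 0, and set R := Δ_N / p_r(N). Then E[|R|^p] = Σ_{n=0}^∞ E[|Δ_n|^p] / p_r(n)^{p−1} (as an equality in [0, ∞]), and if k(p − 1) < β then E[|R|^p] ≤ (A / r^{p−1}) · 1/(1 − 2^{k(p−1)−β}) < ∞. -/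
open MeasureTheory ProbabilityTheory
open scoped ENNReal

/-- The pmf of the geometric distribution `Geo(r)` on `{0,1,2,…}`: `p_r(n) = r (1−r)ⁿ`. -/
noncomputable def pGeo (r : ℝ) (n : ℕ) : ℝ := r * (1 - r) ^ n

/-- If `N` is a countably valued random variable independent of `X`, then the expectation of
`f N X` is obtained by averaging the expectations of `f n X` over the law of `N`. -/
theorem lintegral_eq_tsum_of_indepFun {Ω E ι : Type*} [MeasurableSpace Ω] [MeasurableSpace E]
    [MeasurableSpace ι] [Countable ι] [MeasurableSingletonClass ι] {μ : Measure Ω}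
    {N : Ω → ι} {X : Ω → E} (hN : Measurable N) (hX : Measurable X) (h : IndepFun N X μ)
    {f : ι → E → ℝ≥0∞} (hf : ∀ n, Measurable (f n)) :
    ∫⁻ ω, f (N ω) (X ω) ∂μ = ∑' n, μ (N ⁻¹' {n}) * ∫⁻ ω, f n (X ω) ∂μ := by
  have hset : ∀ n, MeasurableSet (N ⁻¹' {n}) := fun n => hN (measurableSet_singleton n)
  have hunion : ⋃ n, N ⁻¹' {n} = Set.univ := by
    ext ω
    simp
  have hdisj : Pairwise (Function.onFun Disjoint fun n => N ⁻¹' {n}) := fun i j hij =>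
    Disjoint.preimage N (Set.disjoint_singleton.2 hij)
  rw [← setLIntegral_univ, ← hunion, lintegral_iUnion hset hdisj]
  refine tsum_congr fun n => ?_
  have hind : Measurable (Set.indicator {n} (1 : ι → ℝ≥0∞)) :=
    measurable_one.indicator (measurableSet_singleton n)
  calc ∫⁻ ω in N ⁻¹' {n}, f (N ω) (X ω) ∂μ
      = ∫⁻ ω in N ⁻¹' {n}, f n (X ω) ∂μ :=
        setLIntegral_congr_fun (hset n) fun ω (hω : N ω = n) => by simp only [hω]
    _ = ∫⁻ ω, Set.indicator {n} (1 : ι → ℝ≥0∞) (N ω) * f n (X ω) ∂μ := by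
        rw [← lintegral_indicator (hset n)]
        refine lintegral_congr fun ω => ?_
        by_cases hω : N ω = n <;> simp [hω]
    _ = (∫⁻ ω, Set.indicator {n} (1 : ι → ℝ≥0∞) (N ω) ∂μ) * ∫⁻ ω, f n (X ω) ∂μ :=
        lintegral_mul_eq_lintegral_mul_lintegral_of_indepFun'' (hind.comp hN).aemeasurable
          ((hf n).comp hX).aemeasurable (h.comp hind (hf n))
    _ = μ (N ⁻¹' {n}) * ∫⁻ ω, f n (X ω) ∂μ := by
        congr 1
        exact lintegral_indicator_one (hset n)

theorem ofReal_mul_lintegral_abs_div_rpow {Ω : Type*} [MeasurableSpace Ω] (μ : Measure Ω)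
    (X : Ω → ℝ) {c : ℝ} (hc : 0 < c) (p : ℝ) :
    ENNReal.ofReal c * ∫⁻ ω, ENNReal.ofReal (|X ω / c| ^ p) ∂μ =
      (∫⁻ ω, ENNReal.ofReal (|X ω| ^ p) ∂μ) / ENNReal.ofReal (c ^ (p - 1)) := by
  have hpos : 0 < c ^ (p - 1) := Real.rpow_pos_of_pos hc _
  rw [← lintegral_const_mul' _ _ ENNReal.ofReal_ne_top, div_eq_mul_inv,
    ← lintegral_mul_const' _ _ (ENNReal.inv_ne_top.2 (ENNReal.ofReal_pos.2 hpos).ne')]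
  refine lintegral_congr fun ω => ?_
  rw [← ENNReal.ofReal_inv_of_pos hpos, ← ENNReal.ofReal_mul hc.le,
    ← ENNReal.ofReal_mul (by positivity), abs_div, abs_of_pos hc,
    Real.div_rpow (abs_nonneg _) hc.le, Real.rpow_sub_one hc.ne']
  congr 1
  field_simp

theorem pGeo_pos {r : ℝ} (h0 : 0 < r) (h1 : r < 1) (n : ℕ) : 0 < pGeo r n :=
  mul_pos h0 (pow_pos (sub_pos.2 h1) n)

theorem div_pGeo_rpow {r k : ℝ} (hr : r = 1 - (2 : ℝ) ^ (-k)) (h0 : 0 < r) (A β p : ℝ) (n : ℕ) :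
    A * (2 : ℝ) ^ (-(β * n)) / pGeo r n ^ (p - 1) =
      A / r ^ (p - 1) * ((2 : ℝ) ^ (k * (p - 1) - β)) ^ n := by
  have h : 1 - r = (2 : ℝ) ^ (-k) := by rw [hr]; ring
  have hexp : (2 : ℝ) ^ (-(β * n)) =
      ((2 : ℝ) ^ (k * (p - 1) - β)) ^ n * (((2 : ℝ) ^ (-k)) ^ n) ^ (p - 1) := by
    simp only [← Real.rpow_natCast, ← Real.rpow_mul zero_le_two, ← Real.rpow_add zero_lt_two]
    congr 1
    ring
  have hpos : 0 < (((2 : ℝ) ^ (-k)) ^ n) ^ (p - 1) := by positivity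
  rw [pGeo, h, Real.mul_rpow h0.le (by positivity), hexp]
  field_simp

/-- let `p ≥ 1`, `A, β > 0`, `E[|Δ_n|^p] ≤ A·2^{−βn}`, `N ~ Geo(r)` independent of
the sequence with `r = 1 − 2^{−k}`, `k > 0`, and `R := Δ_N / p_r(N)`. Then
`E[|R|^p] = ∑ₙ E[|Δ_n|^p]/p_r(n)^{p−1}` (in `[0,∞]`), and if `k(p−1) < β` then
`E[|R|^p] ≤ (A/r^{p−1}) · 1/(1 − 2^{k(p−1)−β}) < ∞`. -/
theorem stmt_11 (p A β k : ℝ) (hp : 1 ≤ p) (hA : 0 < A) (hβ : 0 < β) (hk : 0 < k)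
    (r : ℝ) (hr : r = 1 - (2 : ℝ) ^ (-k))
    {Ω : Type*} [MeasurableSpace Ω] (μ : Measure Ω) [IsProbabilityMeasure μ]
    (Δ : ℕ → Ω → ℝ) (hΔmeas : ∀ n, Measurable (Δ n))
    (hΔ : ∀ n : ℕ, ∫⁻ ω, ENNReal.ofReal (|Δ n ω| ^ p) ∂μ ≤
      ENNReal.ofReal (A * (2 : ℝ) ^ (-(β * n))))
    (N : Ω → ℕ) (hNmeas : Measurable N)
    (hNlaw : ∀ n : ℕ, μ (N ⁻¹' {n}) = ENNReal.ofReal (pGeo r n))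
    (hindep : IndepFun N (fun ω => fun n : ℕ => Δ n ω) μ)
    (R : Ω → ℝ) (hR : ∀ ω, R ω = Δ (N ω) ω / pGeo r (N ω)) :
    (∫⁻ ω, ENNReal.ofReal (|R ω| ^ p) ∂μ =
      ∑' n : ℕ, (∫⁻ ω, ENNReal.ofReal (|Δ n ω| ^ p) ∂μ) / ENNReal.ofReal (pGeo r n ^ (p - 1))) ∧
    (k * (p - 1) < β →
      ∫⁻ ω, ENNReal.ofReal (|R ω| ^ p) ∂μ ≤
        ENNReal.ofReal (A / r ^ (p - 1) * (1 / (1 - (2 : ℝ) ^ (k * (p - 1) - β))))) := by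
  have h1 : r < 1 := by
    rw [hr]
    exact sub_lt_self _ (Real.rpow_pos_of_pos zero_lt_two _)
  have h0 : 0 < r := by
    rw [hr, sub_pos]
    exact Real.rpow_lt_one_of_one_lt_of_neg one_lt_two (neg_lt_zero.2 hk)
  have hmoment : ∫⁻ ω, ENNReal.ofReal (|R ω| ^ p) ∂μ =
      ∑' n : ℕ, (∫⁻ ω, ENNReal.ofReal (|Δ n ω| ^ p) ∂μ) /
        ENNReal.ofReal (pGeo r n ^ (p - 1)) := by
    simp_rw [hR]
    rw [lintegral_eq_tsum_of_indepFun hNmeas (measurable_pi_lambda _ hΔmeas) hindep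
      (f := fun n x => ENNReal.ofReal (|x n / pGeo r n| ^ p)) fun n => by fun_prop]
    refine tsum_congr fun n => ?_
    rw [hNlaw]
    exact ofReal_mul_lintegral_abs_div_rpow μ (Δ n) (pGeo_pos h0 h1 n) p
  refine ⟨hmoment, fun hkβ => ?_⟩
  have hq0 : 0 ≤ (2 : ℝ) ^ (k * (p - 1) - β) := by positivity
  have hq1 : (2 : ℝ) ^ (k * (p - 1) - β) < 1 :=
    Real.rpow_lt_one_of_one_lt_of_neg one_lt_two (sub_neg.2 hkβ)
  rw [hmoment, one_div, ← tsum_geometric_of_lt_one hq0 hq1, ← tsum_mul_left,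
    ENNReal.ofReal_tsum_of_nonneg (fun n => by positivity)
      ((summable_geometric_of_lt_one hq0 hq1).mul_left _)]
  refine ENNReal.tsum_le_tsum fun n => ?_
  rw [← div_pGeo_rpow hr h0, ENNReal.ofReal_div_of_pos (Real.rpow_pos_of_pos (pGeo_pos h0 h1 n) _)]
  exact ENNReal.div_le_div_right (hΔ n) _
end
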